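/- Under the stochastic smooth setup with gradient interchange, fix x ∈ ℝ^d, and let u and ξ be independent random variables (on a common probability space) with u distributed according to the uniform probability measure on the unit sphere S^{d-1} and ξ distributed according to μ. Then E[|⟨∇f(x, ξ), u⟩|] ≥ c_d ‖∇F(x)‖, where c_d = ∫_{S^{d-1}} |u_1| dσ_S(u) > 0 is the sphere constant and ∇f(x, ω) denotes the gradient of f(·, ω) at x. -/

import Mathlib

open MeasureTheory ProbabilityTheory
open scoped RealInnerProductSpace

/-- In the stochastic smooth setup with gradient interchange, for
independent `u` (uniform on the sphere) and `ξ ∼ μ`,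
`E[|⟨∇f(x,ξ), u⟩|] ≥ c_d ‖∇F(x)‖`, where `c_d = ∫ |u₁| dσ_S(u)`. -/
theorem abs_inner_grad_expectation_ge (d : ℕ) (hd : 1 ≤ d)
    {Ω : Type*} [MeasurableSpace Ω] (μ : Measure Ω) [IsProbabilityMeasure μ]
    (f : EuclideanSpace ℝ (Fin d) → Ω → ℝ)
    (hfmeas : ∀ x, Measurable (f x))
    (hfC2 : ∀ ω, ContDiff ℝ 2 (fun y => f y ω))
    (L : ℝ) (hL : 0 ≤ L)
    (hHess : ∀ x ω, ‖iteratedFDeriv ℝ 2 (fun y => f y ω) x‖ ≤ L)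
    (hfint : ∀ x, Integrable (f x) μ)
    (hgradint : ∀ x, Integrable (fun ω => gradient (fun y => f y ω) x) μ)
    (F : EuclideanSpace ℝ (Fin d) → ℝ) (hF : ∀ x, F x = ∫ ω, f x ω ∂μ)
    (hFdiff : Differentiable ℝ F)
    (hFgrad : ∀ x, gradient F x = ∫ ω, gradient (fun y => f y ω) x ∂μ)
    -- the uniform probability measure on the unit sphere
    (σS : Measure (EuclideanSpace ℝ (Fin d))) [IsProbabilityMeasure σS]
    (hsupp : ∀ᵐ v ∂σS, ‖v‖ = 1)
    (hinv : ∀ R : EuclideanSpace ℝ (Fin d) ≃ₗᵢ[ℝ] EuclideanSpace ℝ (Fin d),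
      σS.map R = σS)
    -- the fixed point
    (x : EuclideanSpace ℝ (Fin d))
    -- the random variables, on a common probability space (Ω', P)
    {Ω' : Type*} [MeasurableSpace Ω'] (P : Measure Ω') [IsProbabilityMeasure P]
    (u : Ω' → EuclideanSpace ℝ (Fin d)) (ξ : Ω' → Ω)
    (humeas : Measurable u) (hξmeas : Measurable ξ)
    (hudist : P.map u = σS) (hξdist : P.map ξ = μ)
    (hindep : IndepFun u ξ P) :
    ∫ ω', |⟪gradient (fun y => f y (ξ ω')) x, u ω'⟫| ∂P
      ≥ (∫ v, |v ⟨0, hd⟩| ∂σS) * ‖gradient F x‖ := by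
  have key : ∀ a : EuclideanSpace ℝ (Fin d),
      ∫ v, |⟪a, v⟫| ∂σS = (∫ v, |v ⟨0, hd⟩| ∂σS) * ‖a‖ := by
    intro a
    set b : EuclideanSpace ℝ (Fin d) := EuclideanSpace.single ⟨0, hd⟩ ‖a‖ with hb
    have hn : ‖b‖ = ‖a‖ := by simp [hb]
    let R : EuclideanSpace ℝ (Fin d) ≃ₗᵢ[ℝ] EuclideanSpace ℝ (Fin d) :=
      (ℝ ∙ (b - a))ᗮ.reflection
    have hR : R b = a := Submodule.reflection_sub hn
    have hRm : Measurable R := R.continuous.measurable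
    calc ∫ v, |⟪a, v⟫| ∂σS = ∫ v, |⟪a, v⟫| ∂(σS.map R) := by rw [hinv R]
      _ = ∫ v, |⟪a, R v⟫| ∂σS := by
          rw [integral_map hRm.aemeasurable]
          exact (by fun_prop : Continuous fun v : EuclideanSpace ℝ (Fin d) =>
            |⟪a, v⟫|).aestronglyMeasurable
      _ = ∫ v, |v ⟨0, hd⟩| * ‖a‖ ∂σS := by
          congr 1
          ext v
          rw [← hR, R.inner_map_map, hR, hb, EuclideanSpace.inner_single_left]
          simp [abs_mul, mul_comm]
      _ = _ := integral_mul_const _ _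
  set g : Ω → EuclideanSpace ℝ (Fin d) := fun ω => gradient (fun y => f y ω) x with hg
  have hgi : Integrable g μ := hgradint x
  have hjoint : P.map (fun ω' => (u ω', ξ ω')) = σS.prod μ := by
    rw [(indepFun_iff_map_prod_eq_prod_map_map humeas.aemeasurable hξmeas.aemeasurable).1 hindep,
      hudist, hξdist]
  have hmeas : AEStronglyMeasurable
      (fun p : EuclideanSpace ℝ (Fin d) × Ω => |⟪g p.2, p.1⟫|) (σS.prod μ) := by
    have h1 : AEStronglyMeasurable (fun p : EuclideanSpace ℝ (Fin d) × Ω => g p.2)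
      (σS.prod μ) := hgi.aestronglyMeasurable.comp_snd
    have h2 : AEStronglyMeasurable (fun p : EuclideanSpace ℝ (Fin d) × Ω => p.1)
      (σS.prod μ) := measurable_fst.aestronglyMeasurable
    have h3 : AEStronglyMeasurable
      (fun p : EuclideanSpace ℝ (Fin d) × Ω => ⟪g p.2, p.1⟫) (σS.prod μ) := h1.inner h2
    exact h3.norm
  have hint : Integrable
      (fun p : EuclideanSpace ℝ (Fin d) × Ω => |⟪g p.2, p.1⟫|) (σS.prod μ) := by
    have h1 : Integrable (fun p : EuclideanSpace ℝ (Fin d) × Ω => g p.2) (σS.prod μ) :=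
      hgi.comp_snd σS
    refine h1.mono hmeas ?_
    have h3 : ∀ᵐ p ∂(σS.prod μ), ‖p.1‖ = 1 :=
      Measure.quasiMeasurePreserving_fst.ae hsupp
    filter_upwards [h3] with p hp
    have := abs_real_inner_le_norm (g p.2) p.1
    rw [hp, mul_one] at this
    simpa using this
  have hE : ∫ ω', |⟪gradient (fun y => f y (ξ ω')) x, u ω'⟫| ∂P
      = ∫ ω, (∫ v, |v ⟨0, hd⟩| ∂σS) * ‖g ω‖ ∂μ := by
    have h := integral_map (humeas.prodMk hξmeas).aemeasurable (μ := P)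
      (f := fun p : EuclideanSpace ℝ (Fin d) × Ω => |⟪g p.2, p.1⟫|) (by rw [hjoint]; exact hmeas)
    rw [hjoint, integral_prod_symm _ hint] at h
    simp only [key] at h
    exact h.symm
  rw [hE, integral_const_mul, hFgrad x, ge_iff_le]
  exact mul_le_mul_of_nonneg_left (norm_integral_le_integral_norm g)
    (integral_nonneg fun v => abs_nonneg _)
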